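/- Let (X^H)_{H∈(0,1)} be a family of centered Gaussian processes on [0,1] with almost surely continuous sample paths such that, for some constants C₁, C₂ > 0 and all H ∈ (0,1), C₁|t−s|^H ≤ ‖X^H_t − X^H_s‖₂ ≤ C₂|t−s|^H for all t, s ∈ [0,1]. Let n : (0,1) → ℕ satisfy n(H) ≥ 2, and suppose limsup_{H→0⁺} Δ_{n(H)}(X^H) < ∞, where Δ_n(X) := E[max_{0≤t≤1} X_t] − E[max_{0≤i≤n} X_{i/n}]. Then liminf_{H→0⁺} (n(H))^H > 1. -/

import Mathlib

open MeasureTheory ProbabilityTheory Real Set Filter Topology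

noncomputable section

/-- `X` is a centered Gaussian process on the time set `S`: every finite linear
combination `∑ i, c i * X (ts i)` of its values at times in `S` is a centered
Gaussian random variable. -/
def IsCenteredGaussianOn {Ω : Type} [MeasurableSpace Ω] (μ : Measure Ω)
    (X : ℝ → Ω → ℝ) (S : Set ℝ) : Prop :=
  (∀ t ∈ S, Measurable (X t)) ∧
  ∀ (k : ℕ) (c : Fin k → ℝ) (ts : Fin k → ℝ), (∀ i, ts i ∈ S) →
    ∃ v : NNReal, μ.map (fun ω => ∑ i, c i * X (ts i) ω) = gaussianReal 0 v

/-- The `L²`-norm `‖Y‖₂ = (E Y²)^{1/2}` of a real random variable. -/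
def l2norm {Ω : Type} [MeasurableSpace Ω] (μ : Measure Ω) (Y : Ω → ℝ) : ℝ :=
  Real.sqrt (∫ ω, (Y ω) ^ 2 ∂μ)

/-- The expected supremum `E [sup_{0 ≤ t ≤ 1} X_t]`. -/
def expMax {Ω : Type} [MeasurableSpace Ω] (μ : Measure Ω) (X : ℝ → Ω → ℝ) : ℝ :=
  ∫ ω, (⨆ t : Icc (0:ℝ) 1, X t.1 ω) ∂μ

/-- The expected maximum over the grid: `E [max_{0 ≤ i ≤ n} X_{i/n}]`. -/
def expMaxGrid {Ω : Type} [MeasurableSpace Ω] (μ : Measure Ω) (X : ℝ → Ω → ℝ) (n : ℕ) : ℝ :=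
  ∫ ω, (⨆ i : Fin (n + 1), X (((i : ℕ) : ℝ) / (n : ℝ)) ω) ∂μ

/-- `B` is a fractional Brownian motion with Hurst parameter `H`: a centered Gaussian
process on `[0,∞)` with a.s. continuous sample paths, `B 0 = 0`, and covariance
`E[B_s B_t] = (s^{2H} + t^{2H} - |t-s|^{2H}) / 2`. -/
def IsFBM {Ω : Type} [MeasurableSpace Ω] (μ : Measure Ω) (H : ℝ) (B : ℝ → Ω → ℝ) : Prop :=
  IsCenteredGaussianOn μ B (Ici 0) ∧
  (∀ᵐ ω ∂μ, ContinuousOn (fun t => B t ω) (Ici 0)) ∧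
  (∀ᵐ ω ∂μ, B 0 ω = 0) ∧
  ∀ s t : ℝ, 0 ≤ s → 0 ≤ t →
    ∫ ω, B s ω * B t ω ∂μ = (s ^ (2 * H) + t ^ (2 * H) - |t - s| ^ (2 * H)) / 2

/-- A finite family of random variables all of whose linear combinations are centered
Gaussian. -/
structure IsJointlyCentered {Ω ι : Type} [Fintype ι] [MeasurableSpace Ω] (μ : Measure Ω)
    (Y : ι → Ω → ℝ) : Prop where
  measurable : ∀ i, Measurable (Y i)
  law : ∀ c : ι → ℝ, ∃ v : NNReal, μ.map (fun ω => ∑ i, c i * Y i ω) = gaussianReal 0 v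

section CenteredGaussian

variable {Ω : Type} [MeasurableSpace Ω] {μ : Measure Ω} {Z : Ω → ℝ} {v : NNReal}

lemma memLp_of_map_eq_gaussianReal (hZ : Measurable Z) (h : μ.map Z = gaussianReal 0 v)
    (p : NNReal) : MemLp Z p μ := by
  have := memLp_id_gaussianReal (μ := 0) (v := v) p
  rw [← h] at this
  exact (memLp_map_measure_iff (by fun_prop) hZ.aemeasurable).1 this

lemma integral_eq_zero_of_map_eq_gaussianReal (hZ : Measurable Z)
    (h : μ.map Z = gaussianReal 0 v) : ∫ ω, Z ω ∂μ = 0 := by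
  have := integral_id_gaussianReal (μ := 0) (v := v)
  rwa [← h, integral_map hZ.aemeasurable (by fun_prop)] at this

lemma integral_sq_of_map_eq_gaussianReal (hZ : Measurable Z)
    (h : μ.map Z = gaussianReal 0 v) : ∫ ω, Z ω ^ 2 ∂μ = v := by
  have h1 := variance_fun_id_gaussianReal (μ := 0) (v := v)
  rw [variance_of_integral_eq_zero (by fun_prop) integral_id_gaussianReal, ← h,
    integral_map hZ.aemeasurable (by fun_prop)] at h1
  exact h1

lemma integrable_exp_of_map_eq_gaussianReal (hZ : Measurable Z)
    (h : μ.map Z = gaussianReal 0 v) (t : ℝ) : Integrable (fun ω => rexp (t * Z ω)) μ := by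
  have := integrable_exp_mul_gaussianReal (μ := 0) (v := v) t
  rw [← h] at this
  exact (integrable_map_measure (by fun_prop) hZ.aemeasurable).1 this

lemma integral_exp_of_map_eq_gaussianReal (hZ : Measurable Z)
    (h : μ.map Z = gaussianReal 0 v) (t : ℝ) :
    ∫ ω, rexp (t * Z ω) ∂μ = rexp (t ^ 2 * (∫ ω, Z ω ^ 2 ∂μ) / 2) := by
  have := mgf_gaussianReal h t
  rw [mgf] at this
  rw [this, integral_sq_of_map_eq_gaussianReal hZ h]
  ring_nf

end CenteredGaussian

/-- Two random vectors with the same, everywhere finite, moment generating functions along all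
directions have the same law. -/
lemma map_eq_map_of_forall_mgf_eq {Ω Ω' ι : Type} [Fintype ι] [MeasurableSpace Ω]
    [MeasurableSpace Ω'] {P : Measure Ω} {P' : Measure Ω'} [IsProbabilityMeasure P]
    [IsProbabilityMeasure P'] {V : ι → Ω → ℝ} {W : ι → Ω' → ℝ}
    (hV : ∀ i, Measurable (V i)) (hW : ∀ i, Measurable (W i))
    (hint : ∀ (c : ι → ℝ) (t : ℝ), Integrable (fun ω => rexp (t * ∑ i, c i * V i ω)) P)
    (h : ∀ c : ι → ℝ, mgf (fun ω => ∑ i, c i * V i ω) P = mgf (fun ω => ∑ i, c i * W i ω) P') :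
    P.map (fun ω i => V i ω) = P'.map (fun ω i => W i ω) := by
  classical
  have hVm : Measurable (fun ω i => V i ω) := measurable_pi_lambda _ hV
  have hWm : Measurable (fun ω i => W i ω) := measurable_pi_lambda _ hW
  have := Measure.isProbabilityMeasure_map (μ := P) hVm.aemeasurable
  have := Measure.isProbabilityMeasure_map (μ := P') hWm.aemeasurable
  refine Measure.ext_of_charFunDual (funext fun L => ?_)
  have hL : ∀ x : ι → ℝ, L x = ∑ i, L (Pi.single i 1) * x i := by
    intro x
    conv_lhs => rw [pi_eq_sum_univ' x]
    simp only [map_sum]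
    refine Finset.sum_congr rfl fun i _ => ?_
    rw [map_smul, smul_eq_mul, mul_comm]
  have key := eqOn_complexMGF_of_mgf (h fun i => L (Pi.single i 1)) (x := Complex.I) (by
    have : integrableExpSet (fun ω => ∑ i, L (Pi.single i 1) * V i ω) P = Set.univ :=
      Set.eq_univ_of_forall fun t => hint _ t
    simp [this])
  rw [charFunDual_apply, charFunDual_apply, integral_map hVm.aemeasurable (by fun_prop),
    integral_map hWm.aemeasurable (by fun_prop)]
  have hexp : ∀ x : ι → ℝ, Complex.exp (L x * Complex.I) =
      Complex.exp (Complex.I * ((∑ i, L (Pi.single i 1) * x i : ℝ) : ℂ)) := fun x => by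
    rw [hL x, mul_comm]
  simp only [hexp]
  exact key

namespace IsJointlyCentered

variable {Ω ι : Type} [Fintype ι] [MeasurableSpace Ω] {μ : Measure Ω} {Y : ι → Ω → ℝ}

lemma law_eval (hY : IsJointlyCentered μ Y) (i : ι) :
    ∃ v : NNReal, μ.map (Y i) = gaussianReal 0 v := by
  classical
  obtain ⟨v, hv⟩ := hY.law (Pi.single i 1)
  exact ⟨v, by simpa [Pi.single_apply] using hv⟩

lemma memLp_two (hY : IsJointlyCentered μ Y) (i : ι) : MemLp (Y i) 2 μ := by
  obtain ⟨v, hv⟩ := hY.law_eval i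
  exact mod_cast memLp_of_map_eq_gaussianReal (hY.measurable i) hv 2

lemma integrable_mul (hY : IsJointlyCentered μ Y) (i j : ι) :
    Integrable (fun ω => Y i ω * Y j ω) μ :=
  (hY.memLp_two i).integrable_mul (hY.memLp_two j)

lemma measurable_sum (hY : IsJointlyCentered μ Y) (c : ι → ℝ) :
    Measurable (fun ω => ∑ i, c i * Y i ω) :=
  Finset.measurable_fun_sum _ fun i _ => (hY.measurable i).const_mul _

variable [IsProbabilityMeasure μ]

lemma map_neg_eq (hY : IsJointlyCentered μ Y) :
    μ.map (fun ω i => Y i ω) = μ.map (fun ω i => -Y i ω) := by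
  refine map_eq_map_of_forall_mgf_eq hY.measurable (fun i => (hY.measurable i).neg) ?_ ?_
  · intro c t
    obtain ⟨v, hv⟩ := hY.law c
    exact integrable_exp_of_map_eq_gaussianReal (hY.measurable_sum c) hv t
  · intro c
    ext t
    obtain ⟨v, hv⟩ := hY.law c
    have h1 := integral_exp_of_map_eq_gaussianReal (hY.measurable_sum c) hv t
    have h2 := integral_exp_of_map_eq_gaussianReal (hY.measurable_sum c) hv (-t)
    simp only [mgf]
    simp only [mul_neg, Finset.sum_neg_distrib]
    simp only [neg_mul] at h2
    rw [h1, h2]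
    ring_nf

/-- The Cameron–Martin shift of a Gaussian vector along the covariances with one of its
coordinates. -/
lemma map_tilted_eq (hY : IsJointlyCentered μ Y) (i : ι) (r : ℝ) :
    (μ.tilted (fun ω => -r * Y i ω)).map (fun ω j => Y j ω) =
      μ.map (fun ω j => Y j ω - r * ∫ ω, Y i ω * Y j ω ∂μ) := by
  classical
  obtain ⟨vi, hvi⟩ := hY.law_eval i
  have hie := integrable_exp_of_map_eq_gaussianReal (hY.measurable i) hvi (-r)
  have := isProbabilityMeasure_tilted hie
  have hcomb : ∀ (c : ι → ℝ) (t : ℝ) (ω : Ω), -r * Y i ω + t * ∑ j, c j * Y j ω =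
      1 * ∑ j, (t * c j - r * Pi.single (M := fun _ => ℝ) i 1 j) * Y j ω := by
    intro c t ω
    simp only [sub_mul, Finset.sum_sub_distrib, Finset.mul_sum, Pi.single_apply]
    simp [mul_assoc]
    ring
  refine map_eq_map_of_forall_mgf_eq hY.measurable
    (fun j => (hY.measurable j).sub_const _) ?_ ?_
  · intro c t
    rw [integrable_tilted_iff (by exact hie)]
    obtain ⟨v, hv⟩ := hY.law (fun j => t * c j - r * Pi.single (M := fun _ => ℝ) i 1 j)
    have := integrable_exp_of_map_eq_gaussianReal (hY.measurable_sum _) hv 1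
    refine this.congr (ae_of_all _ fun ω => ?_)
    simp only [smul_eq_mul]
    rw [← hcomb, ← Real.exp_add]
  · intro c
    ext t
    simp only [mgf]
    rw [integral_exp_tilted]
    obtain ⟨v, hv⟩ := hY.law (fun j => t * c j - r * Pi.single (M := fun _ => ℝ) i 1 j)
    obtain ⟨v', hv'⟩ := hY.law c
    have e1 := integral_exp_of_map_eq_gaussianReal (hY.measurable_sum _) hv 1
    have e2 := integral_exp_of_map_eq_gaussianReal (hY.measurable i) hvi (-r)
    have e3 := integral_exp_of_map_eq_gaussianReal (hY.measurable_sum _) hv' t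
    simp only [Pi.add_apply]
    simp_rw [hcomb]
    rw [e1, e2]
    have e4 : ∀ ω, rexp (t * ∑ j, c j * (Y j ω - r * ∫ ω, Y i ω * Y j ω ∂μ)) =
        rexp (t * ∑ j, c j * Y j ω) *
          rexp (-(t * r * ∫ ω, Y i ω * (∑ j, c j * Y j ω) ∂μ)) := by
      intro ω
      rw [← Real.exp_add]
      congr 1
      simp only [Finset.mul_sum]
      rw [integral_finsetSum]
      · rw [Finset.mul_sum, ← sub_eq_add_neg, ← Finset.sum_sub_distrib]
        refine Finset.sum_congr rfl fun j _ => ?_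
        have : ∫ ω, Y i ω * (c j * Y j ω) ∂μ = c j * ∫ ω, Y i ω * Y j ω ∂μ := by
          rw [← integral_const_mul]
          congr 1
          ext ω
          ring
        rw [this]
        ring
      · intro j _
        have := (hY.integrable_mul i j).const_mul (c j)
        refine this.congr (ae_of_all _ fun ω => ?_)
        simp only
        ring
    simp_rw [e4]
    rw [integral_mul_const, e3, ← Real.exp_add, ← Real.exp_sub]
    congr 1
    have hS : MemLp (fun ω => ∑ j, c j * Y j ω) 2 μ :=
      mod_cast memLp_of_map_eq_gaussianReal (hY.measurable_sum _) hv' 2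
    have hi := hY.memLp_two i
    have e5 : ∫ ω, (∑ j, (t * c j - r * Pi.single (M := fun _ => ℝ) i 1 j) * Y j ω) ^ 2 ∂μ =
        r ^ 2 * (∫ ω, Y i ω ^ 2 ∂μ) - 2 * r * t * (∫ ω, Y i ω * (∑ j, c j * Y j ω) ∂μ)
          + t ^ 2 * ∫ ω, (∑ j, c j * Y j ω) ^ 2 ∂μ := by
      rw [← integral_const_mul, ← integral_const_mul, ← integral_const_mul, ← integral_sub,
        ← integral_add]
      · congr 1
        ext ω
        have := hcomb c t ω
        rw [one_mul] at this
        rw [← this]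
        ring
      · exact (hi.integrable_sq.const_mul _).sub ((hi.integrable_mul hS).const_mul _)
      · exact hS.integrable_sq.const_mul _
      · exact hi.integrable_sq.const_mul _
      · exact (hi.integrable_mul hS).const_mul _
    rw [e5]
    ring

/-- A Sudakov-type minoration for Gaussian vectors with bounded variances. -/
lemma log_card_le (hY : IsJointlyCentered μ Y) [Nonempty ι] {a b W : ℝ} (ha : 0 < a) (hW : 0 < W)
    (hvar : ∀ i, ∫ ω, Y i ω ^ 2 ∂μ ≤ b ^ 2)
    (hsep : ∀ i j, i ≠ j → a ^ 2 ≤ ∫ ω, (Y i ω - Y j ω) ^ 2 ∂μ)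
    (hprob : 1 / 2 ≤ μ.real {ω | ∀ i, |Y i ω| ≤ 2 * W}) :
    Real.log (Fintype.card ι) ≤
      Real.log 2 + 18 * W ^ 2 / a ^ 2 + 81 * W ^ 2 * b ^ 2 / (2 * a ^ 4) := by
  set r : ℝ := 9 * W / a ^ 2 with hr
  have hr0 : 0 < r := by positivity
  set C : ι → ι → ℝ := fun i j => ∫ ω, Y i ω * Y j ω ∂μ with hC
  let K : Set (ι → ℝ) := {x | ∀ i, |x i| ≤ 2 * W}
  have hK : MeasurableSet K := by
    have : K = ⋂ i, {x | |x i| ≤ 2 * W} := by ext; simp [K]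
    rw [this]
    exact MeasurableSet.iInter fun i => measurableSet_le (by fun_prop) (by fun_prop)
  have hYm : Measurable (fun ω j => Y j ω) := measurable_pi_lambda _ hY.measurable
  let E : ι → Set Ω := fun i => (fun ω j => Y j ω - r * C i j) ⁻¹' K
  have hEm : ∀ i, MeasurableSet (E i) := fun i =>
    (measurable_pi_lambda _ fun j => (hY.measurable j).sub_const _) hK
  have hdisj : Pairwise (Function.onFun Disjoint E) := by
    intro i j hij
    rw [Function.onFun, Set.disjoint_left]
    intro ω hi hj
    have h1 := abs_le.1 (hi i)
    have h2 := abs_le.1 (hi j)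
    have h3 := abs_le.1 (hj i)
    have h4 := abs_le.1 (hj j)
    have hs := hsep i j hij
    have e : ∫ ω, (Y i ω - Y j ω) ^ 2 ∂μ = C i i - C i j - C j i + C j j := by
      simp only [hC]
      rw [← integral_sub, ← integral_sub, ← integral_add]
      · congr 1
        ext ω
        ring
      · exact ((hY.integrable_mul _ _).sub (hY.integrable_mul _ _)).sub (hY.integrable_mul _ _)
      · exact hY.integrable_mul _ _
      · exact (hY.integrable_mul _ _).sub (hY.integrable_mul _ _)
      · exact hY.integrable_mul _ _
      · exact hY.integrable_mul _ _
      · exact hY.integrable_mul _ _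
    rw [e] at hs
    have h5 : r * a ^ 2 = 9 * W := by rw [hr]; field_simp
    have h6 := mul_le_mul_of_nonneg_left hs hr0.le
    simp only at h1 h2 h3 h4
    nlinarith
  set q : ℝ := rexp (-(r * (2 * W)) - r ^ 2 * b ^ 2 / 2) with hq
  have hlow : ∀ i, q * (1 / 2) ≤ μ.real (E i) := by
    intro i
    obtain ⟨vi, hvi⟩ := hY.law_eval i
    have hie := integrable_exp_of_map_eq_gaussianReal (hY.measurable i) hvi (-r)
    have e1 : μ (E i) = (μ.tilted (fun ω => -r * Y i ω)) ((fun ω j => Y j ω) ⁻¹' K) := by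
      rw [← Measure.map_apply hYm hK, hY.map_tilted_eq i r, Measure.map_apply _ hK]
      exact measurable_pi_lambda _ fun j => (hY.measurable j).sub_const _
    rw [Measure.real, e1, tilted_apply_eq_ofReal_integral' _ (hYm hK), ENNReal.toReal_ofReal,
      integral_exp_of_map_eq_gaussianReal (hY.measurable i) hvi (-r)]
    · calc q * (1 / 2) ≤ q * μ.real ((fun ω j => Y j ω) ⁻¹' K) := by
            refine mul_le_mul_of_nonneg_left hprob (Real.exp_pos _).le
        _ = ∫ ω in (fun ω j => Y j ω) ⁻¹' K, q ∂μ := by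
            rw [setIntegral_const, smul_eq_mul, mul_comm]
        _ ≤ _ := by
            refine setIntegral_mono_on (integrable_const _).integrableOn
              (hie.div_const _).integrableOn (hYm hK) fun ω hω => ?_
            rw [← Real.exp_sub, hq]
            refine Real.exp_le_exp.2 ?_
            have h1 := (abs_le.1 (hω i)).2
            have h2 := hvar i
            have h3 := mul_le_mul_of_nonneg_left h1 hr0.le
            have h4 := mul_le_mul_of_nonneg_left h2 (sq_nonneg r)
            simp only at h3
            nlinarith
    · exact setIntegral_nonneg (hYm hK) fun ω _ => by positivity
  have hsum : ∑ i, μ.real (E i) ≤ 1 := by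
    rw [← measureReal_biUnion_finset (fun i _ j _ hij => hdisj hij) fun i _ => hEm i]
    exact measureReal_le_one
  have hcard : (Fintype.card ι : ℝ) * (q * (1 / 2)) ≤ 1 := by
    refine le_trans ?_ hsum
    have := Finset.sum_le_sum fun i (_ : i ∈ Finset.univ) => hlow i
    simpa using this
  have hN : (0 : ℝ) < Fintype.card ι := by exact_mod_cast Fintype.card_pos
  have hlog := Real.log_le_log (by positivity) hcard
  rw [Real.log_mul hN.ne' (by positivity), Real.log_mul (Real.exp_pos _).ne' (by norm_num),
    Real.log_exp, Real.log_one, one_div, Real.log_inv] at hlog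
  have f1 : r * (2 * W) = 18 * W ^ 2 / a ^ 2 := by rw [hr]; field_simp; ring
  have f2 : r ^ 2 * b ^ 2 / 2 = 81 * W ^ 2 * b ^ 2 / (2 * a ^ 4) := by rw [hr]; field_simp; ring
  linarith

end IsJointlyCentered

section FiniteMaximum

variable {Ω ι : Type} [Fintype ι] [Nonempty ι] [MeasurableSpace Ω] {μ : Measure Ω}
  {Y : ι → Ω → ℝ}

lemma integrable_iSup_of_fintype (hm : ∀ i, Measurable (Y i)) (hi : ∀ i, Integrable (Y i) μ) :
    Integrable (fun ω => ⨆ i, Y i ω) μ := by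
  refine (integrable_finsetSum Finset.univ fun i _ => (hi i).abs).mono'
    (Measurable.iSup hm).aestronglyMeasurable (ae_of_all _ fun ω => ?_)
  obtain ⟨i, hi⟩ := exists_eq_ciSup_of_finite (f := fun i => Y i ω)
  rw [← hi, Real.norm_eq_abs]
  exact Finset.single_le_sum (f := fun i => |Y i ω|) (fun _ _ => abs_nonneg _) (Finset.mem_univ i)

/-- The maximal inequality for finitely many centered Gaussian variables. -/
lemma integral_iSup_abs_le [IsProbabilityMeasure μ] (hm : ∀ i, Measurable (Y i))
    (hlaw : ∀ i, ∃ v : NNReal, μ.map (Y i) = gaussianReal 0 v) {σ s : ℝ}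
    (hvar : ∀ i, ∫ ω, Y i ω ^ 2 ∂μ ≤ σ ^ 2) (hs : 0 < s) :
    ∫ ω, (⨆ i, |Y i ω|) ∂μ ≤ Real.log (2 * Fintype.card ι) / s + s * σ ^ 2 / 2 := by
  set A : ℝ := 2 * Fintype.card ι * rexp (s ^ 2 * σ ^ 2 / 2) with hA
  have hN : (0 : ℝ) < Fintype.card ι := by exact_mod_cast Fintype.card_pos
  have hA0 : 0 < A := by positivity
  have hint : ∀ i t, Integrable (fun ω => rexp (t * Y i ω)) μ := fun i t => by
    obtain ⟨v, hv⟩ := hlaw i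
    exact integrable_exp_of_map_eq_gaussianReal (hm i) hv t
  have hle : ∀ i t, t ^ 2 = s ^ 2 → ∫ ω, rexp (t * Y i ω) ∂μ ≤ rexp (s ^ 2 * σ ^ 2 / 2) := by
    intro i t ht
    obtain ⟨v, hv⟩ := hlaw i
    rw [integral_exp_of_map_eq_gaussianReal (hm i) hv t, ht]
    have := mul_le_mul_of_nonneg_left (hvar i) (sq_nonneg s)
    exact Real.exp_le_exp.2 (by linarith)
  have hYint : ∀ i, Integrable (Y i) μ := fun i => by
    obtain ⟨v, hv⟩ := hlaw i
    exact memLp_one_iff_integrable.1 (mod_cast memLp_of_map_eq_gaussianReal (hm i) hv 1)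
  have hsup : Integrable (fun ω => ⨆ i, |Y i ω|) μ :=
    integrable_iSup_of_fintype (fun i => (hm i).abs) fun i => (hYint i).abs
  have hpt : ∀ ω, s * (⨆ i, |Y i ω|) ≤
      (∑ i, (rexp (s * Y i ω) + rexp (-s * Y i ω))) / A - 1 + Real.log A := by
    intro ω
    obtain ⟨i, hi⟩ := exists_eq_ciSup_of_finite (f := fun i => |Y i ω|)
    rw [← hi]
    have h1 := Real.add_one_le_exp (s * |Y i ω| - Real.log A)
    rw [Real.exp_sub, Real.exp_log hA0] at h1
    have h2 : rexp (s * |Y i ω|) ≤ ∑ i, (rexp (s * Y i ω) + rexp (-s * Y i ω)) := by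
      refine le_trans ?_ (Finset.single_le_sum
        (f := fun i => rexp (s * Y i ω) + rexp (-s * Y i ω)) (fun _ _ => by positivity)
        (Finset.mem_univ i))
      rcases abs_cases (Y i ω) with ⟨h, -⟩ | ⟨h, -⟩
      · rw [h]
        exact le_add_of_nonneg_right (Real.exp_pos _).le
      · rw [h, mul_neg, ← neg_mul]
        exact le_add_of_nonneg_left (Real.exp_pos _).le
    have h3 := div_le_div_of_nonneg_right h2 hA0.le
    linarith
  have hpair : ∀ i, Integrable (fun ω => rexp (s * Y i ω) + rexp (-s * Y i ω)) μ :=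
    fun i => (hint i s).add (hint i (-s))
  have hsumint : Integrable (fun ω => ∑ i, (rexp (s * Y i ω) + rexp (-s * Y i ω))) μ :=
    integrable_finsetSum _ fun i _ => hpair i
  have hshift : Integrable
      (fun ω => (∑ i, (rexp (s * Y i ω) + rexp (-s * Y i ω))) / A - 1) μ :=
    (hsumint.div_const A).sub (integrable_const 1)
  have hmono := integral_mono (hsup.const_mul s) (hshift.add (integrable_const (Real.log A))) hpt
  have hE : ∫ ω, ((∑ i, (rexp (s * Y i ω) + rexp (-s * Y i ω))) / A - 1 + Real.log A) ∂μ ≤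
      Real.log A := by
    rw [integral_add hshift (integrable_const _),
      integral_sub (hsumint.div_const A) (integrable_const 1), integral_div,
      integral_finsetSum _ fun i _ => hpair i]
    have : ∑ i, ∫ ω, (rexp (s * Y i ω) + rexp (-s * Y i ω)) ∂μ ≤ A := by
      refine (Finset.sum_le_card_nsmul _ _ (2 * rexp (s ^ 2 * σ ^ 2 / 2)) fun i _ => ?_).trans ?_
      · rw [integral_add (hint i s) (hint i (-s))]
        linarith [hle i s rfl, hle i (-s) (by ring)]
      · rw [hA, nsmul_eq_mul, Finset.card_univ]
        exact le_of_eq (by ring)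
    have := (div_le_one hA0).2 this
    simp only [integral_const, probReal_univ, smul_eq_mul, one_mul]
    linarith
  rw [integral_const_mul] at hmono
  have hlogA : Real.log A = Real.log (2 * Fintype.card ι) + s ^ 2 * σ ^ 2 / 2 := by
    rw [hA, Real.log_mul (by positivity) (Real.exp_pos _).ne', Real.log_exp]
  have hfin := hmono.trans (hE.trans hlogA.le)
  have : Real.log (2 * Fintype.card ι) / s + s * σ ^ 2 / 2 =
      (Real.log (2 * Fintype.card ι) + s ^ 2 * σ ^ 2 / 2) / s := by
    field_simp
  rw [this, le_div_iff₀ hs, mul_comm]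
  exact hfin

end FiniteMaximum

lemma ContinuousOn.tendsto_iSup_dyadic {f : ℝ → ℝ} (hf : ContinuousOn f (Icc 0 1)) :
    Tendsto (fun m : ℕ => ⨆ j : Fin (2 ^ m + 1), f ((j : ℕ) / 2 ^ m)) atTop
      (𝓝 (⨆ t : Icc (0 : ℝ) 1, f t)) := by
  obtain ⟨t, ht, hmax⟩ := isCompact_Icc.exists_isMaxOn (nonempty_Icc.2 zero_le_one) hf
  have hne : Nonempty (Icc (0 : ℝ) 1) := ⟨⟨t, ht⟩⟩
  have hsup : ⨆ t : Icc (0 : ℝ) 1, f t = f t := by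
    refine le_antisymm (ciSup_le fun s => hmax s.2) ?_
    exact le_ciSup (f := fun s : Icc (0 : ℝ) 1 => f s)
      ⟨f t, by rintro _ ⟨s, rfl⟩; exact hmax s.2⟩ ⟨t, ht⟩
  rw [hsup]
  have hpow : Tendsto (fun m : ℕ => (2 : ℝ) ^ m) atTop atTop :=
    tendsto_pow_atTop_atTop_of_one_lt one_lt_two
  have hfloor : Tendsto (fun m : ℕ => (⌊t * 2 ^ m⌋₊ : ℝ) / 2 ^ m) atTop (𝓝 t) :=
    (tendsto_nat_floor_mul_div_atTop ht.1).comp hpow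
  have hmem : ∀ m : ℕ, ⌊t * 2 ^ m⌋₊ ≤ 2 ^ m := fun m => by
    refine Nat.floor_le_of_le ?_
    push_cast
    exact mul_le_of_le_one_left (by positivity) ht.2
  have hgrid : ∀ (m j : ℕ), j ≤ 2 ^ m → (j : ℝ) / 2 ^ m ∈ Icc (0 : ℝ) 1 := fun m j hj =>
    ⟨by positivity, (div_le_one (by positivity)).2 (by exact_mod_cast hj)⟩
  have hlim : Tendsto (fun m : ℕ => f ((⌊t * 2 ^ m⌋₊ : ℝ) / 2 ^ m)) atTop (𝓝 (f t)) :=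
    (hf t ht).tendsto.comp (tendsto_nhdsWithin_iff.2
      ⟨hfloor, Eventually.of_forall fun m => hgrid m _ (hmem m)⟩)
  refine tendsto_of_tendsto_of_tendsto_of_le_of_le hlim tendsto_const_nhds (fun m => ?_)
    fun m => ciSup_le fun j => hmax (hgrid m j (Nat.lt_succ_iff.1 j.2))
  exact le_ciSup (f := fun j : Fin (2 ^ m + 1) => f ((j : ℕ) / 2 ^ m))
    (Set.finite_range _).bddAbove ⟨⌊t * 2 ^ m⌋₊, Nat.lt_succ_iff.2 (hmem m)⟩

namespace IsCenteredGaussianOn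

variable {Ω : Type} [MeasurableSpace Ω] {μ : Measure Ω} {X : ℝ → Ω → ℝ} {S : Set ℝ}

lemma isJointlyCentered_sub (hX : IsCenteredGaussianOn μ X S) {k : ℕ} {t u : Fin k → ℝ}
    (ht : ∀ i, t i ∈ S) (hu : ∀ i, u i ∈ S) :
    IsJointlyCentered μ (fun i ω => X (t i) ω - X (u i) ω) where
  measurable i := (hX.1 _ (ht i)).sub (hX.1 _ (hu i))
  law c := by
    obtain ⟨v, hv⟩ := hX.2 (k + k) (Fin.append c fun i => -c i) (Fin.append t u) fun i => by
      induction i using Fin.addCases with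
      | left i => simpa using ht i
      | right i => rw [Fin.append_right]; exact hu i
    refine ⟨v, hv ▸ ?_⟩
    congr 1
    ext ω
    rw [Fin.sum_univ_add]
    simp only [Fin.append_left, Fin.append_right]
    rw [← Finset.sum_add_distrib]
    exact Finset.sum_congr rfl fun i _ => by ring

lemma law_eval (hX : IsCenteredGaussianOn μ X S) {t : ℝ} (ht : t ∈ S) :
    ∃ v : NNReal, μ.map (X t) = gaussianReal 0 v := by
  obtain ⟨v, hv⟩ := hX.2 1 (fun _ => 1) (fun _ => t) fun _ => ht
  exact ⟨v, by simpa using hv⟩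

lemma integrable (hX : IsCenteredGaussianOn μ X S) {t : ℝ} (ht : t ∈ S) :
    Integrable (X t) μ := by
  obtain ⟨v, hv⟩ := hX.law_eval ht
  exact memLp_one_iff_integrable.1 (mod_cast memLp_of_map_eq_gaussianReal (hX.1 t ht) hv 1)

lemma integral_eq_zero (hX : IsCenteredGaussianOn μ X S) {t : ℝ} (ht : t ∈ S) :
    ∫ ω, X t ω ∂μ = 0 := by
  obtain ⟨v, hv⟩ := hX.law_eval ht
  exact integral_eq_zero_of_map_eq_gaussianReal (hX.1 t ht) hv

lemma integrable_iSup_abs_sub (hX : IsCenteredGaussianOn μ X S) {k : ℕ} [NeZero k]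
    {t u : Fin k → ℝ} (ht : ∀ i, t i ∈ S) (hu : ∀ i, u i ∈ S) :
    Integrable (fun ω => ⨆ i, |X (t i) ω - X (u i) ω|) μ :=
  integrable_iSup_of_fintype (fun i => ((hX.1 _ (ht i)).sub (hX.1 _ (hu i))).abs)
    fun i => ((hX.integrable (ht i)).sub (hX.integrable (hu i))).abs

variable [IsProbabilityMeasure μ]

lemma integral_iSup_abs_sub_le (hX : IsCenteredGaussianOn μ X S) {C H : ℝ} (hC : 0 < C)
    (hH : 0 < H) (hupp : ∀ s ∈ S, ∀ t ∈ S, l2norm μ (fun ω => X t ω - X s ω) ≤ C * |t - s| ^ H)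
    {k : ℕ} [NeZero k] {t u : Fin k → ℝ} (ht : ∀ i, t i ∈ S) (hu : ∀ i, u i ∈ S) {d s : ℝ}
    (hd : ∀ i, |t i - u i| ≤ d) (hs : 0 < s) :
    ∫ ω, (⨆ i, |X (t i) ω - X (u i) ω|) ∂μ ≤
      Real.log (2 * k) / s + s * (C * d ^ H) ^ 2 / 2 := by
  have hJ := hX.isJointlyCentered_sub ht hu
  have := integral_iSup_abs_le hJ.measurable hJ.law_eval (σ := C * d ^ H) (fun i => ?_) hs
  · simpa using this
  · have h1 := hupp _ (hu i) _ (ht i)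
    rw [l2norm, Real.sqrt_le_left (by positivity)] at h1
    refine h1.trans ?_
    have := Real.rpow_le_rpow (abs_nonneg _) (hd i) hH.le
    gcongr

lemma integral_iSup_abs_dyadic_le (hX : IsCenteredGaussianOn μ X (Icc 0 1)) {C H : ℝ}
    (hC : 0 < C) (hH : 0 < H)
    (hupp : ∀ s ∈ Icc (0 : ℝ) 1, ∀ t ∈ Icc (0 : ℝ) 1,
      l2norm μ (fun ω => X t ω - X s ω) ≤ C * |t - s| ^ H) :
    ∃ B : ℝ, ∀ m : ℕ,
      ∫ ω, (⨆ j : Fin (2 ^ m + 1), |X ((j : ℕ) / 2 ^ m) ω - X 0 ω|) ∂μ ≤ B := by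
  have h0 : (0 : ℝ) ∈ Icc (0 : ℝ) 1 := ⟨le_rfl, zero_le_one⟩
  have hgrid : ∀ (m j : ℕ), j ≤ 2 ^ m → (j : ℝ) / 2 ^ m ∈ Icc (0 : ℝ) 1 := fun m j hj =>
    ⟨by positivity, (div_le_one (by positivity)).2 (by exact_mod_cast hj)⟩
  set ρ : ℝ := (1 / 2) ^ H with hρ
  have hρ0 : 0 < ρ := by positivity
  have hρ1 : ρ < 1 := Real.rpow_lt_one (by norm_num) (by norm_num) hH
  set D : ℕ → ℝ := fun m => C * ((m + 2) * ρ ^ (m + 1)) with hD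
  have hDsum : Summable D := by
    have h1 : Summable fun m : ℕ => (m : ℝ) ^ 1 * ρ ^ m :=
      summable_pow_mul_geometric_of_norm_lt_one 1 (by rwa [Real.norm_of_nonneg hρ0.le])
    have h2 : Summable fun m : ℕ => ρ ^ m := summable_geometric_of_lt_one hρ0.le hρ1
    have := ((h1.add (h2.mul_left 2)).mul_left ρ).mul_left C
    refine this.congr fun m => ?_
    simp only [hD]
    ring
  have hDnn : ∀ m, 0 ≤ D m := fun m => by positivity
  set Z : ℕ → Ω → ℝ := fun m ω => ⨆ j : Fin (2 ^ m + 1), |X ((j : ℕ) / 2 ^ m) ω - X 0 ω|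
  have hZ : ∀ m, Integrable (Z m) μ := fun m =>
    hX.integrable_iSup_abs_sub (t := fun j : Fin (2 ^ m + 1) => ((j : ℕ) : ℝ) / 2 ^ m)
      (u := fun _ => 0) (fun j => hgrid m j (Nat.lt_succ_iff.1 j.2)) fun _ => h0
  have hstep : ∀ m, ∫ ω, Z (m + 1) ω ∂μ ≤ ∫ ω, Z m ω ∂μ + D m := by
    intro m
    set t : Fin (2 ^ m) → ℝ := fun i => ((2 * (i : ℕ) + 1 : ℕ) : ℝ) / 2 ^ (m + 1) with ht
    set u : Fin (2 ^ m) → ℝ := fun i => ((i : ℕ) : ℝ) / 2 ^ m with hu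
    have htm : ∀ i, t i ∈ Icc (0 : ℝ) 1 := fun i => hgrid (m + 1) _ (by
      have := i.2
      rw [pow_succ]
      omega)
    have hum : ∀ i, u i ∈ Icc (0 : ℝ) 1 := fun i => hgrid m _ i.2.le
    have hM := hX.integrable_iSup_abs_sub htm hum
    have htu : ∀ i, |t i - u i| ≤ (1 / 2) ^ (m + 1) := by
      intro i
      have : t i - u i = (1 / 2) ^ (m + 1) := by
        simp only [ht, hu]
        push_cast
        rw [pow_succ, one_div, inv_pow, pow_succ]
        field_simp
        ring
      rw [this, abs_of_nonneg (by positivity)]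
    have hpw : ((1 / 2 : ℝ) ^ (m + 1)) ^ H = ρ ^ (m + 1) := by
      rw [hρ, ← Real.rpow_natCast, ← Real.rpow_mul (by norm_num), mul_comm,
        Real.rpow_mul (by norm_num), Real.rpow_natCast]
    have hMle := hX.integral_iSup_abs_sub_le hC hH hupp htm hum htu
      (s := 1 / (C * ρ ^ (m + 1))) (by positivity)
    have hMD : ∫ ω, (⨆ i, |X (t i) ω - X (u i) ω|) ∂μ ≤ D m := by
      refine hMle.trans ?_
      rw [hpw]
      have hlog : Real.log (2 * ((2 ^ m : ℕ) : ℝ)) ≤ m + 1 := by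
        push_cast
        rw [← pow_succ', Real.log_pow]
        push_cast
        have := Real.log_two_lt_d9
        have h : (0 : ℝ) ≤ m + 1 := by positivity
        nlinarith
      have e : Real.log (2 * ((2 ^ m : ℕ) : ℝ)) / (1 / (C * ρ ^ (m + 1))) +
          1 / (C * ρ ^ (m + 1)) * (C * ρ ^ (m + 1)) ^ 2 / 2 =
          (C * ρ ^ (m + 1)) * (Real.log (2 * ((2 ^ m : ℕ) : ℝ)) + 1 / 2) := by
        field_simp
      rw [e]
      simp only [hD]
      have : C * ((m + 2) * ρ ^ (m + 1)) = (C * ρ ^ (m + 1)) * (m + 2) := by ring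
      rw [this]
      exact mul_le_mul_of_nonneg_left (by linarith) (by positivity)
    have hpt : ∀ ω, Z (m + 1) ω ≤ Z m ω + ⨆ i, |X (t i) ω - X (u i) ω| := by
      intro ω
      refine ciSup_le fun j => ?_
      have hZle : ∀ i : ℕ, i ≤ 2 ^ m → |X ((i : ℝ) / 2 ^ m) ω - X 0 ω| ≤ Z m ω := fun i hi =>
        le_ciSup (f := fun j : Fin (2 ^ m + 1) => |X ((j : ℕ) / 2 ^ m) ω - X 0 ω|)
          (Set.finite_range _).bddAbove ⟨i, Nat.lt_succ_iff.2 hi⟩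
      have hj : (j : ℕ) ≤ 2 * 2 ^ m := by
        have h2 : 2 ^ (m + 1) = 2 * 2 ^ m := pow_succ' 2 m
        have := j.2
        omega
      rcases Nat.even_or_odd' (j : ℕ) with ⟨i, hi | hi⟩
      · have e : ((j : ℕ) : ℝ) / 2 ^ (m + 1) = (i : ℝ) / 2 ^ m := by
          rw [hi, pow_succ]
          push_cast
          field_simp
        rw [e]
        exact (hZle i (by omega)).trans
          (le_add_of_nonneg_right (Real.iSup_nonneg fun _ => abs_nonneg _))
      · have hi' : i < 2 ^ m := by omega
        have h1 := le_ciSup (f := fun i => |X (t i) ω - X (u i) ω|)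
          (Set.finite_range _).bddAbove ⟨i, hi'⟩
        have h2 := hZle i hi'.le
        have e : ((j : ℕ) : ℝ) / 2 ^ (m + 1) = t ⟨i, hi'⟩ := by rw [hi]
        rw [e]
        exact (abs_sub_le _ (X (u ⟨i, hi'⟩) ω) _).trans (by linarith)
    have := integral_mono (hZ (m + 1)) ((hZ m).add hM) hpt
    simp only [Pi.add_apply] at this
    rw [integral_add (hZ m) hM] at this
    linarith
  refine ⟨∫ ω, Z 0 ω ∂μ + ∑' m, D m, fun m => ?_⟩
  have : ∀ m, ∫ ω, Z m ω ∂μ ≤ ∫ ω, Z 0 ω ∂μ + ∑ i ∈ Finset.range m, D i := by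
    intro m
    induction m with
    | zero => simp
    | succ m ih =>
      rw [Finset.sum_range_succ]
      linarith [hstep m]
  exact (this m).trans (by gcongr; exact hDsum.sum_le_tsum _ fun i _ => hDnn i)

/-- The supremum of a continuous Gaussian process with Hölder increments is integrable. -/
lemma integrable_iSup (hX : IsCenteredGaussianOn μ X (Icc 0 1))
    (hcont : ∀ᵐ ω ∂μ, ContinuousOn (fun t => X t ω) (Icc 0 1)) {C H : ℝ}
    (hC : 0 < C) (hH : 0 < H)
    (hupp : ∀ s ∈ Icc (0 : ℝ) 1, ∀ t ∈ Icc (0 : ℝ) 1,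
      l2norm μ (fun ω => X t ω - X s ω) ≤ C * |t - s| ^ H) :
    Integrable (fun ω => ⨆ t : Icc (0 : ℝ) 1, X t.1 ω) μ := by
  obtain ⟨B, hB⟩ := hX.integral_iSup_abs_dyadic_le hC hH hupp
  have h0 : (0 : ℝ) ∈ Icc (0 : ℝ) 1 := ⟨le_rfl, zero_le_one⟩
  have hgrid : ∀ (m : ℕ) (j : Fin (2 ^ m + 1)), ((j : ℕ) : ℝ) / 2 ^ m ∈ Icc (0 : ℝ) 1 :=
    fun m j => ⟨by positivity,
      (div_le_one (by positivity)).2 (by exact_mod_cast Nat.lt_succ_iff.1 j.2)⟩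
  have hVm : ∀ m : ℕ, Measurable (fun ω => ⨆ j : Fin (2 ^ m + 1), X ((j : ℕ) / 2 ^ m) ω) :=
    fun m => Measurable.iSup fun j => hX.1 _ (hgrid m j)
  have hlim : ∀ᵐ ω ∂μ, Tendsto
      (fun m : ℕ => ⨆ j : Fin (2 ^ m + 1), X ((j : ℕ) / 2 ^ m) ω) atTop
      (𝓝 (⨆ t : Icc (0 : ℝ) 1, X t.1 ω)) := by
    filter_upwards [hcont] with ω hω using hω.tendsto_iSup_dyadic
  refine memLp_one_iff_integrable.1
    ⟨aestronglyMeasurable_of_tendsto_ae _ (fun m => (hVm m).aestronglyMeasurable) hlim, ?_⟩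
  refine (Lp.eLpNorm_lim_le_liminf_eLpNorm (fun m => (hVm m).aestronglyMeasurable) _ hlim).trans_lt
    ?_
  have hbound : ∀ m : ℕ,
      eLpNorm (fun ω => ⨆ j : Fin (2 ^ m + 1), X ((j : ℕ) / 2 ^ m) ω) 1 μ ≤
        ENNReal.ofReal (∫ ω, |X 0 ω| ∂μ + B) := by
    intro m
    have hZ := hX.integrable_iSup_abs_sub (hgrid m) (u := fun _ => 0) fun _ => h0
    have hg : Integrable (fun ω => |X 0 ω| +
        ⨆ j : Fin (2 ^ m + 1), |X ((j : ℕ) / 2 ^ m) ω - X 0 ω|) μ :=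
      (hX.integrable h0).abs.add hZ
    calc eLpNorm (fun ω => ⨆ j : Fin (2 ^ m + 1), X ((j : ℕ) / 2 ^ m) ω) 1 μ
        ≤ eLpNorm (fun ω => |X 0 ω| +
            ⨆ j : Fin (2 ^ m + 1), |X ((j : ℕ) / 2 ^ m) ω - X 0 ω|) 1 μ := by
          refine eLpNorm_mono_real fun ω => ?_
          obtain ⟨j, hj⟩ := exists_eq_ciSup_of_finite
            (f := fun j : Fin (2 ^ m + 1) => X ((j : ℕ) / 2 ^ m) ω)
          have h1 := le_ciSup
            (f := fun j : Fin (2 ^ m + 1) => |X ((j : ℕ) / 2 ^ m) ω - X 0 ω|)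
            (Set.finite_range _).bddAbove j
          rw [← hj, Real.norm_eq_abs]
          have h2 := abs_add_le (X ((j : ℕ) / 2 ^ m) ω - X 0 ω) (X 0 ω)
          rw [sub_add_cancel] at h2
          linarith
      _ = ENNReal.ofReal (∫ ω, (|X 0 ω| +
            ⨆ j : Fin (2 ^ m + 1), |X ((j : ℕ) / 2 ^ m) ω - X 0 ω|) ∂μ) := by
          rw [eLpNorm_one_eq_lintegral_enorm, ofReal_integral_eq_lintegral_ofReal hg]
          · refine lintegral_congr fun ω => Real.enorm_of_nonneg ?_
            exact add_nonneg (abs_nonneg _) (Real.iSup_nonneg fun _ => abs_nonneg _)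
          · exact ae_of_all _ fun ω =>
              add_nonneg (abs_nonneg _) (Real.iSup_nonneg fun _ => abs_nonneg _)
      _ ≤ _ := by
          refine ENNReal.ofReal_le_ofReal ?_
          rw [integral_add (hX.integrable h0).abs hZ]
          linarith [hB m]
  refine lt_of_le_of_lt ?_ (ENNReal.ofReal_lt_top (r := ∫ ω, |X 0 ω| ∂μ + B))
  refine (liminf_le_liminf (Eventually.of_forall hbound)).trans ?_
  simp

lemma integral_iSup_abs_sub_le_two_mul_expMax (hX : IsCenteredGaussianOn μ X (Icc 0 1))
    (hcont : ∀ᵐ ω ∂μ, ContinuousOn (fun t => X t ω) (Icc 0 1))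
    (hsup : Integrable (fun ω => ⨆ t : Icc (0 : ℝ) 1, X t.1 ω) μ) {k : ℕ} {t : Fin k → ℝ}
    (ht : ∀ i, t i ∈ Icc (0 : ℝ) 1) (i₀ : Fin k) (hi₀ : t i₀ = 0) :
    ∫ ω, (⨆ i, |X (t i) ω - X 0 ω|) ∂μ ≤ 2 * expMax μ X := by
  have h0 : (0 : ℝ) ∈ Icc (0 : ℝ) 1 := ⟨le_rfl, zero_le_one⟩
  have hne : Nonempty (Fin k) := ⟨i₀⟩
  have hJ := hX.isJointlyCentered_sub ht (u := fun _ => 0) fun _ => h0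
  set Y : Fin k → Ω → ℝ := fun i ω => X (t i) ω - X 0 ω with hY
  have hYi : ∀ i, Integrable (Y i) μ := fun i => (hX.integrable (ht i)).sub (hX.integrable h0)
  have hpos : Integrable (fun ω => ⨆ i, Y i ω) μ := integrable_iSup_of_fintype hJ.measurable hYi
  have hneg : Integrable (fun ω => ⨆ i, -Y i ω) μ :=
    integrable_iSup_of_fintype (fun i => (hJ.measurable i).neg) fun i => (hYi i).neg
  have habs : Integrable (fun ω => ⨆ i, |Y i ω|) μ :=
    integrable_iSup_of_fintype (fun i => (hJ.measurable i).abs) fun i => (hYi i).abs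
  have hsymm : ∫ ω, (⨆ i, -Y i ω) ∂μ = ∫ ω, (⨆ i, Y i ω) ∂μ := by
    have hF : Measurable (fun y : Fin k → ℝ => ⨆ i, y i) := Measurable.iSup measurable_pi_apply
    have h1 := integral_map (μ := μ) (measurable_pi_lambda _ hJ.measurable).aemeasurable
      hF.aestronglyMeasurable
    have h2 := integral_map (μ := μ)
      (measurable_pi_lambda _ fun i => (hJ.measurable i).neg).aemeasurable
      hF.aestronglyMeasurable
    rw [← h1, hJ.map_neg_eq]
    exact h2.symm
  have hpt : ∀ ω, (⨆ i, |Y i ω|) ≤ (⨆ i, Y i ω) + ⨆ i, -Y i ω := by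
    intro ω
    have hp : ∀ i, Y i ω ≤ ⨆ i, Y i ω := le_ciSup (Set.finite_range _).bddAbove
    have hn : ∀ i, -Y i ω ≤ ⨆ i, -Y i ω := le_ciSup (Set.finite_range _).bddAbove
    have hz : Y i₀ ω = 0 := by simp [hY, hi₀]
    have hp0 := hp i₀
    have hn0 := hn i₀
    rw [hz] at hp0 hn0
    refine ciSup_le fun i => ?_
    have hpi := hp i
    have hni := hn i
    exact abs_le.2 ⟨by linarith, by linarith⟩
  have hle : ∫ ω, (⨆ i, Y i ω) ∂μ ≤ expMax μ X := by
    have h1 : ∫ ω, (⨆ i, Y i ω) ∂μ ≤ ∫ ω, ((⨆ t : Icc (0 : ℝ) 1, X t.1 ω) - X 0 ω) ∂μ := by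
      refine integral_mono_ae hpos (hsup.sub (hX.integrable h0)) ?_
      filter_upwards [hcont] with ω hω
      have hbdd : BddAbove (Set.range fun t : Icc (0 : ℝ) 1 => X t.1 ω) := by
        have := isCompact_Icc.bddAbove_image hω
        rwa [Set.image_eq_range] at this
      refine ciSup_le fun i => sub_le_sub_right ?_ _
      exact le_ciSup hbdd ⟨t i, ht i⟩
    rwa [integral_sub hsup (hX.integrable h0), hX.integral_eq_zero h0, sub_zero] at h1
  have h2 := integral_mono habs (hpos.add hneg) hpt
  simp only [Pi.add_apply] at h2
  rw [integral_add hpos hneg, hsymm] at h2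
  linarith

lemma expMaxGrid_le (hX : IsCenteredGaussianOn μ X (Icc 0 1)) {C H : ℝ} (hC : 0 < C)
    (hH : 0 < H) (hupp : ∀ s ∈ Icc (0 : ℝ) 1, ∀ t ∈ Icc (0 : ℝ) 1,
      l2norm μ (fun ω => X t ω - X s ω) ≤ C * |t - s| ^ H)
    {n : ℕ} (hn : 0 < n) {s : ℝ} (hs : 0 < s) :
    expMaxGrid μ X n ≤ Real.log (2 * (n + 1)) / s + s * C ^ 2 / 2 := by
  have h0 : (0 : ℝ) ∈ Icc (0 : ℝ) 1 := ⟨le_rfl, zero_le_one⟩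
  have hn' : (0 : ℝ) < n := by exact_mod_cast hn
  have hgrid : ∀ i : Fin (n + 1), ((i : ℕ) : ℝ) / n ∈ Icc (0 : ℝ) 1 := fun i =>
    ⟨by positivity, (div_le_one hn').2 (by exact_mod_cast Nat.lt_succ_iff.1 i.2)⟩
  have hZ := hX.integrable_iSup_abs_sub hgrid (u := fun _ => 0) fun _ => h0
  have hle := hX.integral_iSup_abs_sub_le hC hH hupp hgrid (u := fun _ => 0) (fun _ => h0)
    (d := 1) (fun i => by rw [sub_zero, abs_of_nonneg (hgrid i).1]; exact (hgrid i).2) hs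
  rw [Real.one_rpow, mul_one] at hle
  push_cast at hle
  refine le_trans ?_ hle
  have hmono := integral_mono
    (integrable_iSup_of_fintype (fun i => hX.1 _ (hgrid i)) fun i => hX.integrable (hgrid i))
    ((hX.integrable h0).add hZ) fun ω => ciSup_le fun i => by
      have h1 := le_ciSup (f := fun i : Fin (n + 1) => |X ((i : ℕ) / n) ω - X 0 ω|)
        (Set.finite_range _).bddAbove i
      have h2 := le_abs_self (X ((i : ℕ) / n) ω - X 0 ω)
      simp only [Pi.add_apply]
      linarith
  simp only [Pi.add_apply] at hmono
  rwa [integral_add (hX.integrable h0) hZ, hX.integral_eq_zero h0, zero_add] at hmono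

/-- Sudakov minoration for a Gaussian process with two-sided Hölder increments. -/
lemma inv_le_of_expMax_le (hX : IsCenteredGaussianOn μ X (Icc 0 1))
    (hcont : ∀ᵐ ω ∂μ, ContinuousOn (fun t => X t ω) (Icc 0 1)) {C₁ C₂ H W : ℝ}
    (hC₁ : 0 < C₁) (hC₂ : 0 < C₂) (hH : H ∈ Ioo (0 : ℝ) 1)
    (hlow : ∀ s ∈ Icc (0 : ℝ) 1, ∀ t ∈ Icc (0 : ℝ) 1,
      C₁ * |t - s| ^ H ≤ l2norm μ (fun ω => X t ω - X s ω))
    (hupp : ∀ s ∈ Icc (0 : ℝ) 1, ∀ t ∈ Icc (0 : ℝ) 1,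
      l2norm μ (fun ω => X t ω - X s ω) ≤ C₂ * |t - s| ^ H)
    (hW : 0 < W) (hle : 2 * expMax μ X ≤ W) :
    1 / H ≤ 2 * Real.log 2 +
      (18 / (C₁ * rexp (-1)) ^ 2 + 81 * C₂ ^ 2 / (2 * (C₁ * rexp (-1)) ^ 4)) * W ^ 2 := by
  obtain ⟨hH0, hH1⟩ := hH
  have h0 : (0 : ℝ) ∈ Icc (0 : ℝ) 1 := ⟨le_rfl, zero_le_one⟩
  set N : ℕ := ⌊rexp (1 / H)⌋₊ with hN
  have hexp : 1 ≤ rexp (1 / H) := Real.one_le_exp (by positivity)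
  have hN1 : 1 ≤ N := Nat.le_floor (by exact_mod_cast hexp)
  have hN1' : (1 : ℝ) ≤ N := by exact_mod_cast hN1
  have hN0 : (0 : ℝ) < N := by linarith
  have hNle : (N : ℝ) ≤ rexp (1 / H) := Nat.floor_le (Real.exp_pos _).le
  have hNge : rexp (1 / H) / 2 ≤ N := by
    have := Nat.lt_floor_add_one (rexp (1 / H))
    rw [← hN] at this
    linarith
  have hlogN : 1 / H - Real.log 2 ≤ Real.log N := by
    have := Real.log_le_log (by positivity) hNge
    rwa [Real.log_div (Real.exp_pos _).ne' two_ne_zero, Real.log_exp] at this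
  have hpow : rexp (-1) ≤ (1 / (N : ℝ)) ^ H := by
    rw [one_div, Real.inv_rpow hN0.le, Real.exp_neg]
    refine inv_anti₀ (by positivity) ?_
    refine (Real.rpow_le_rpow hN0.le hNle hH0.le).trans ?_
    rw [← Real.exp_mul, one_div, inv_mul_cancel₀ hH0.ne']
  set t : Fin N → ℝ := fun i => ((i : ℕ) : ℝ) / N with ht_def
  have ht : ∀ i, t i ∈ Icc (0 : ℝ) 1 := fun i =>
    ⟨by positivity, (div_le_one hN0).2 (by exact_mod_cast i.2.le)⟩
  have : NeZero N := ⟨by omega⟩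
  have hJ := hX.isJointlyCentered_sub ht (u := fun _ => 0) fun _ => h0
  have hsup := hX.integrable_iSup hcont hC₂ hH0 hupp
  have hEle := (hX.integral_iSup_abs_sub_le_two_mul_expMax hcont hsup ht 0 (by simp [t])).trans hle
  have hZ := hX.integrable_iSup_abs_sub ht (u := fun _ => 0) fun _ => h0
  set Z : Ω → ℝ := fun ω => ⨆ i, |X (t i) ω - X 0 ω|
  have hprob : 1 / 2 ≤ μ.real {ω | ∀ i, |X (t i) ω - X 0 ω| ≤ 2 * W} := by
    have hmarkov := mul_meas_ge_le_integral_of_nonneg (μ := μ) (f := Z)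
      (ae_of_all _ fun ω => Real.iSup_nonneg fun _ => abs_nonneg _) hZ (2 * W)
    have hhalf : μ.real {ω | 2 * W ≤ Z ω} ≤ 1 / 2 := by
      have h := hmarkov.trans hEle
      nlinarith
    have hsub : {ω | 2 * W ≤ Z ω}ᶜ ⊆ {ω | ∀ i, |X (t i) ω - X 0 ω| ≤ 2 * W} := by
      intro ω hω i
      exact (le_ciSup (f := fun i => |X (t i) ω - X 0 ω|) (Set.finite_range _).bddAbove i).trans
        (not_le.1 (show ¬2 * W ≤ Z ω from hω)).le
    have hcompl : 1 ≤ μ.real {ω | 2 * W ≤ Z ω} + μ.real {ω | 2 * W ≤ Z ω}ᶜ := by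
      rw [← probReal_univ (μ := μ), ← Set.union_compl_self {ω | 2 * W ≤ Z ω}]
      exact measureReal_union_le _ _
    have := measureReal_mono (μ := μ) hsub
    linarith
  have hcard := hJ.log_card_le (a := C₁ * rexp (-1)) (b := C₂) (by positivity) hW
    (fun i => ?_) (fun i j hij => ?_) hprob
  · rw [Fintype.card_fin] at hcard
    have e : (18 / (C₁ * rexp (-1)) ^ 2 + 81 * C₂ ^ 2 / (2 * (C₁ * rexp (-1)) ^ 4)) * W ^ 2 =
        18 * W ^ 2 / (C₁ * rexp (-1)) ^ 2 +
          81 * W ^ 2 * C₂ ^ 2 / (2 * (C₁ * rexp (-1)) ^ 4) := by ring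
    rw [e]
    linarith
  · have h1 := hupp _ h0 _ (ht i)
    have h2 : C₂ * |t i - 0| ^ H ≤ C₂ := by
      refine mul_le_of_le_one_right hC₂.le (Real.rpow_le_one (abs_nonneg _) ?_ hH0.le)
      rw [sub_zero, abs_of_nonneg (ht i).1]
      exact (ht i).2
    exact (Real.sqrt_le_left hC₂.le).1 (h1.trans h2)
  · have h1 := hlow _ (ht j) _ (ht i)
    have hdist : 1 / (N : ℝ) ≤ |t i - t j| := by
      have hij' : ((i : ℕ) : ℤ) - (j : ℕ) ≠ 0 := by
        intro h
        exact hij (Fin.ext (by omega))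
      have h2 : (1 : ℝ) ≤ |((i : ℕ) : ℝ) - (j : ℕ)| := by
        exact_mod_cast Int.one_le_abs hij'
      simp only [ht_def]
      rw [← sub_div, abs_div, abs_of_pos hN0]
      exact div_le_div_of_nonneg_right h2 hN0.le
    have h3 : C₁ * rexp (-1) ≤ C₁ * |t i - t j| ^ H :=
      mul_le_mul_of_nonneg_left
        (hpow.trans (Real.rpow_le_rpow (by positivity) hdist hH0.le)) hC₁.le
    have h4 := (Real.le_sqrt' (by positivity)).1 (h3.trans h1)
    simpa using h4

end IsCenteredGaussianOn

/-- if `Δ_{n(H)} (X^H)` stays bounded as `H → 0⁺` for a family of generalized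
quasihelices, then `liminf_{H→0⁺} (n(H))^H > 1`, i.e. some `c > 1` is an eventual lower
bound for `(n(H))^H`. -/
theorem stmt6 {Ω : Type} [MeasurableSpace Ω] (μ : Measure Ω) [IsProbabilityMeasure μ]
    (X : ℝ → ℝ → Ω → ℝ) (C₁ C₂ : ℝ) (hC₁ : 0 < C₁) (hC₂ : 0 < C₂)
    (hgauss : ∀ H ∈ Ioo (0:ℝ) 1, IsCenteredGaussianOn μ (X H) (Icc 0 1))
    (hcont : ∀ H ∈ Ioo (0:ℝ) 1, ∀ᵐ ω ∂μ, ContinuousOn (fun t => X H t ω) (Icc 0 1))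
    (hlow : ∀ H ∈ Ioo (0:ℝ) 1, ∀ s ∈ Icc (0:ℝ) 1, ∀ t ∈ Icc (0:ℝ) 1,
      C₁ * |t - s| ^ H ≤ l2norm μ (fun ω => X H t ω - X H s ω))
    (hupp : ∀ H ∈ Ioo (0:ℝ) 1, ∀ s ∈ Icc (0:ℝ) 1, ∀ t ∈ Icc (0:ℝ) 1,
      l2norm μ (fun ω => X H t ω - X H s ω) ≤ C₂ * |t - s| ^ H)
    (n : ℝ → ℕ) (hn : ∀ H ∈ Ioo (0:ℝ) 1, 2 ≤ n H)
    (hlimsup : ∃ M : ℝ, ∀ᶠ H in 𝓝[>] (0:ℝ),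
      expMax μ (X H) - expMaxGrid μ (X H) (n H) ≤ M) :
    ∃ c : ℝ, 1 < c ∧ ∀ᶠ H in 𝓝[>] (0:ℝ), c ≤ (n H : ℝ) ^ H := by
  obtain ⟨M, hM⟩ := hlimsup
  set Γ : ℝ := 18 / (C₁ * rexp (-1)) ^ 2 + 81 * C₂ ^ 2 / (2 * (C₁ * rexp (-1)) ^ 4) with hΓ
  have hΓ0 : 0 < Γ := by positivity
  set B : ℝ := 3 + C₂ ^ 2 / 2 with hB
  have hB0 : 0 < B := by positivity
  set L : ℝ := max M 1 with hL
  have hL1 : 1 ≤ L := le_max_right _ _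
  set κ : ℝ := 1 / (16 * Γ * B ^ 2) with hκ
  have hκ0 : 0 < κ := by positivity
  set Q : ℝ := 2 * Real.log 2 + 8 * Γ * L ^ 2 with hQ
  have hQ0 : 0 < Q := by
    have := Real.log_pos one_lt_two
    positivity
  refine ⟨rexp κ, Real.one_lt_exp_iff.2 hκ0, ?_⟩
  have hδ : (0 : ℝ) < min 1 (1 / (2 * Q)) := by positivity
  filter_upwards [hM, Ioo_mem_nhdsGT hδ] with H hMH hH
  have hH0 : 0 < H := hH.1
  have hHmem : H ∈ Ioo (0 : ℝ) 1 := ⟨hH0, hH.2.trans_le (min_le_left _ _)⟩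
  by_contra! hlt
  have hn2 := hn H hHmem
  have hn2' : (2 : ℝ) ≤ n H := by exact_mod_cast hn2
  have hn0 : (0 : ℝ) < n H := by linarith
  have hlogn : H * Real.log (n H) < κ := by
    have := Real.log_lt_log (Real.rpow_pos_of_pos hn0 H) hlt
    rwa [Real.log_rpow hn0, Real.log_exp] at this
  set s : ℝ := √(κ / H) with hs
  have hs0 : 0 < s := Real.sqrt_pos.2 (by positivity)
  have hs2 : s ^ 2 = κ / H := Real.sq_sqrt (by positivity)
  have hlog : Real.log (2 * (n H + 1)) ≤ 3 * s ^ 2 := by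
    have h1 : 2 * ((n H : ℝ) + 1) ≤ (n H : ℝ) ^ 3 := by
      nlinarith [mul_nonneg (sub_nonneg.2 hn2') (sub_nonneg.2 hn2'), pow_pos hn0 2]
    have h2 := Real.log_le_log (by positivity) h1
    rw [Real.log_pow] at h2
    have h3 : Real.log (n H) ≤ κ / H := by
      rw [le_div_iff₀ hH0, mul_comm]
      exact hlogn.le
    rw [hs2]
    push_cast at h2
    linarith
  have hgrid := (hgauss H hHmem).expMaxGrid_le hC₂ hH0 (hupp H hHmem) (n := n H) (by omega) hs0
  have hgrid' : expMaxGrid μ (X H) (n H) ≤ s * B := by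
    have h1 : Real.log (2 * (n H + 1)) / s ≤ 3 * s := by
      rw [div_le_iff₀ hs0]
      linarith
    rw [hB]
    linarith
  have hmax : 2 * expMax μ (X H) ≤ 2 * (L + s * B) := by
    have := le_max_left M 1
    linarith
  have hmain := (hgauss H hHmem).inv_le_of_expMax_le (hcont H hHmem) hC₁ hC₂ hHmem
    (hlow H hHmem) (hupp H hHmem) (W := 2 * (L + s * B)) (by positivity) hmax
  rw [← hΓ] at hmain
  have hW : (2 * (L + s * B)) ^ 2 ≤ 8 * L ^ 2 + 8 * B ^ 2 * (κ / H) := by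
    rw [← hs2]
    nlinarith [sq_nonneg (L - s * B)]
  have hΓW := mul_le_mul_of_nonneg_left hW hΓ0.le
  have hcancel : Γ * (8 * B ^ 2 * (κ / H)) = 1 / H / 2 := by
    rw [hκ]
    field_simp
    norm_num
  have hinv : 1 / H ≤ 2 * Q := by
    rw [hQ]
    linarith
  have hHQ : H < 1 / (2 * Q) := hH.2.trans_le (min_le_right _ _)
  have := one_div_lt_one_div_of_lt hH0 hHQ
  rw [one_div_one_div] at this
  linarith
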